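/- There is no infinite word w : ℕ → Σ₃ that simultaneously contains no factor of exponent 5/2 or greater, has factor complexity equal to 2n+1 for every n ≥ 0, and contains none of the words 00, 12, 21, 22, 0101, 1010 as a factor. -/

import Mathlib

/-! Common definitions: the alphabet Σ₃, finite and infinite words, factors,
factor complexity, periods and exponents, morphisms, the morphism γ and its
fixed point G = γ^ω(0). -/

abbrev Sigma3 := Fin 3
abbrev Word := List Sigma3
abbrev InfWord := ℕ → Sigma3

/-- `u` is a factor of the infinite word `w`. -/
def IsFactor (u : Word) (w : InfWord) : Prop :=
  ∃ i : ℕ, u = (List.range u.length).map (fun j => w (i + j))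

/-- The set of finite factors of `w`. -/
def Lang (w : InfWord) : Set Word := {u | IsFactor u w}

/-- Factor complexity: the number of distinct length-`n` factors of `w`. -/
noncomputable def complexity (w : InfWord) (n : ℕ) : ℕ :=
  Set.ncard {u : Word | IsFactor u w ∧ u.length = n}

/-- `v` has period `p` (with `p ≥ 1`). -/
def HasPeriod (v : Word) (p : ℕ) : Prop :=
  1 ≤ p ∧ ∀ i, i + p < v.length → v.getD i 0 = v.getD (i + p) 0

/-- The least period of `v`. -/
noncomputable def minPeriod (v : Word) : ℕ := sInf {p | HasPeriod v p}

/-- The exponent `|v| / p` of a nonempty finite word `v`, where `p` is its least period. -/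
noncomputable def expo (v : Word) : ℝ := (v.length : ℝ) / (minPeriod v : ℝ)

/-- `w` contains no factor of exponent `5/2` or greater. -/
def NoFiveHalves (w : InfWord) : Prop :=
  ∀ u : Word, u ≠ [] → IsFactor u w → expo u < 5 / 2

/-- Apply a morphism (given by the images of the three letters) to a finite word. -/
def applyM (f : Sigma3 → Word) (u : Word) : Word := (u.map f).flatten

/-- The image under `f` of the length-`k` prefix of the infinite word `u`. -/
def imPrefix (f : Sigma3 → Word) (u : InfWord) (k : ℕ) : Word :=
  applyM f ((List.range k).map u)

/-- The image of an infinite word under a (non-erasing) morphism. -/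
def applyMInf (f : Sigma3 → Word) (u : InfWord) : InfWord :=
  fun n => (imPrefix f u (n + 1)).getD n 0

/-- The morphism `γ = [01, 2, 02]`. -/
def gam : Sigma3 → Word := ![[0, 1], [2], [0, 2]]

/-- The fixed point `G = γ^ω(0)` of `γ`, the unique infinite fixed point beginning with 0. -/
def G : InfWord := fun n => ((applyM gam)^[n + 1] [0]).getD n 0

/-- The final segment of `w` starting at position `k`. -/
def shift (w : InfWord) (k : ℕ) : InfWord := fun i => w (i + k)

/-- The reverse `h^R` of a morphism `h`. -/
def mR (f : Sigma3 → Word) : Sigma3 → Word := fun x => (f x).reverse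

/-- The length-`n` factor of `w` at position `s`, last letter first. -/
def revFactor (w : InfWord) (s n : ℕ) : Word :=
  ((List.range n).map fun j => w (s + j)).reverse

/-- Whether `u` and `v` both have length at least `k` and agree on their first `k` letters. -/
def agreeUpTo : ℕ → Word → Word → Bool
  | 0, _, _ => true
  | k + 1, a :: u, b :: v => Nat.beq a.1 b.1 && agreeUpTo k u v
  | _ + 1, _, _ => false

/-- Whether the reversed word `u` begins with a word of period `p` and length `⌈5p/2⌉`. -/
def startsWithPower (u : Word) (p : ℕ) : Bool :=
  agreeUpTo ((3 * p + 1) / 2) u (u.drop p)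

/-- Whether the reversed word `u` begins with a word in `forb` or a power of exponent `≥ 5/2`. -/
def startsBadly (forb : List Word) (u : Word) : Bool :=
  forb.any (fun f => agreeUpTo f.length f u) ||
    [1, 2, 3, 4, 5, 8, 9, 12, 17, 21, 22, 38].any (startsWithPower u)

/-- The first `k` letters of `u` as a base-4 numeral. -/
def letterCode (k : ℕ) (u : Word) : ℕ :=
  (u.take k).foldl (fun c a => 4 * c + a.1) 0

/-- Continue with the codes of the length-`k` factors, updated with the one at the head of `u`,
or accept if there are now more than `2 * k + 1` of them. -/
def addCode (k : ℕ) (u : Word) (seen : List ℕ) (cont : List ℕ → Bool) : Bool :=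
  bif Nat.blt u.length k then cont seen
  else bif seen.any (Nat.beq (letterCode k u)) then cont seen
  else bif Nat.blt (2 * k) seen.length then true
  else cont (letterCode k u :: seen)

/-- Whether every extension of the reversed word `u` by `fuel` letters either has more than
`2 * k + 1` factors of length `k`, or contains a reversed word in `forb` or a power of exponent
`≥ 5/2`; `seen` lists the codes met so far. -/
def search (k : ℕ) (forb : List Word) : ℕ → Word → List ℕ → Bool
  | 0, _, _ => false
  | fuel + 1, u, seen =>
    startsBadly forb u || addCode k u seen fun seen' =>
      search k forb fuel (0 :: u) seen' && search k forb fuel (1 :: u) seen' &&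
        search k forb fuel (2 :: u) seen'

/-- Reversed words that cannot occur, each because of the ones after it. -/
def forbiddenReversed : List Word :=
  [[0], [2, 0, 1, 1, 0, 2, 0], [1, 1, 0, 2, 0, 1, 1, 0, 2, 0], [2, 0, 2],
    [0, 0], [2, 1], [1, 2], [2, 2], [1, 0, 1, 0], [0, 1, 0, 1]]

theorem search_202 :
    search 3 (forbiddenReversed.drop 4) 30 [2, 0, 2] [] = true := by decide +kernel

theorem search_0201102011 :
    search 9 (forbiddenReversed.drop 3) 100 [1, 1, 0, 2, 0, 1, 1, 0, 2, 0] [] = true := by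
  decide +kernel

theorem search_0201102 :
    search 9 (forbiddenReversed.drop 2) 100 [2, 0, 1, 1, 0, 2, 0] [] = true := by decide +kernel

theorem search_0 :
    search 9 (forbiddenReversed.drop 1) 100 [0] [] = true := by decide +kernel

theorem search_nil : search 9 forbiddenReversed 100 [] [] = true := by decide +kernel

theorem length_revFactor (w : InfWord) (s n : ℕ) : (revFactor w s n).length = n := by
  simp [revFactor]

theorem revFactor_succ (w : InfWord) (s n : ℕ) :
    revFactor w s (n + 1) = w (s + n) :: revFactor w s n := by
  simp [revFactor, List.range_succ]

theorem getElem?_revFactor (w : InfWord) (s n j : ℕ) :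
    (revFactor w s n)[j]? = if j < n then some (w (s + (n - 1 - j))) else none := by
  by_cases hj : j < n
  · have : n - 1 - j < n := by omega
    rw [if_pos hj, revFactor, List.getElem?_reverse (by simpa using hj)]
    simp [this]
  · rw [if_neg hj, List.getElem?_eq_none (by simpa [length_revFactor] using hj)]

theorem isFactor_map_range (w : InfWord) (s l : ℕ) :
    IsFactor ((List.range l).map fun j => w (s + j)) w :=
  ⟨s, by simp⟩

theorem take_revFactor {w : InfWord} {s n k : ℕ} (hk : k ≤ n) :
    (revFactor w s n).take k = revFactor w (s + (n - k)) k := by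
  refine List.ext_getElem? fun i => ?_
  rw [List.getElem?_take, getElem?_revFactor, getElem?_revFactor]
  by_cases hi : i < k
  · rw [if_pos hi, if_pos (by omega), if_pos hi]
    congr 2
    omega
  · rw [if_neg hi, if_neg hi]

theorem exists_getElem?_of_agreeUpTo {k : ℕ} {u v : Word} (h : agreeUpTo k u v = true) {i : ℕ}
    (hi : i < k) : ∃ a, u[i]? = some a ∧ v[i]? = some a := by
  induction k generalizing u v i with
  | zero => omega
  | succ k ih =>
    match u, v, h with
    | a :: u, b :: v, h =>
      simp only [agreeUpTo, Bool.and_eq_true] at h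
      cases i with
      | zero => exact ⟨a, rfl, congrArg some (Fin.ext (Nat.eq_of_beq_eq_true h.1)).symm⟩
      | succ i => simpa using ih h.2 (Nat.lt_of_succ_lt_succ hi)
    | [], _, h => simp [agreeUpTo] at h
    | _ :: _, [], h => simp [agreeUpTo] at h

theorem NoFiveHalves.not_periodic {w : InfWord} (hw : NoFiveHalves w) {s p l : ℕ} (hp : 1 ≤ p)
    (hl : 5 * p ≤ 2 * l) : ¬ ∀ i, i + p < l → w (s + i) = w (s + (i + p)) := by
  intro h
  set v : Word := (List.range l).map fun j => w (s + j) with hv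
  have hlen : v.length = l := by simp [hv]
  have hper : HasPeriod v p := by
    refine ⟨hp, fun i hi => ?_⟩
    rw [hlen] at hi
    have hi' : i < l := by omega
    simpa [hv, List.getD_eq_getElem?_getD, hi, hi'] using h i hi
  have hle : minPeriod v ≤ p := Nat.sInf_le hper
  have hpos : 1 ≤ minPeriod v := (Nat.sInf_mem (s := {p | HasPeriod v p}) ⟨p, hper⟩).1
  have hne : v ≠ [] := List.ne_nil_of_length_pos (by omega)
  have hlt := hw v hne (isFactor_map_range w s l)
  have hpos' : (0 : ℝ) < minPeriod v := by exact_mod_cast hpos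
  rw [expo, hlen, div_lt_iff₀ hpos'] at hlt
  have hle' : (minPeriod v : ℝ) ≤ p := by exact_mod_cast hle
  have hl' : (5 * p : ℝ) ≤ 2 * l := by exact_mod_cast hl
  linarith

theorem NoFiveHalves.startsWithPower_eq_false {w : InfWord} (hw : NoFiveHalves w) (s n : ℕ)
    {p : ℕ} (hp : 1 ≤ p) : startsWithPower (revFactor w s n) p = false := by
  rw [← Bool.not_eq_true]
  intro h
  set k := (3 * p + 1) / 2 with hk
  have key : ∀ j < k, p + j < n ∧ w (s + (n - 1 - j)) = w (s + (n - 1 - (p + j))) := by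
    intro j hj
    obtain ⟨a, h1, h2⟩ := exists_getElem?_of_agreeUpTo h hj
    rw [List.getElem?_drop] at h2
    simp only [getElem?_revFactor, Option.ite_none_right_eq_some, Option.some.injEq] at h1 h2
    exact ⟨h2.1, h1.2.trans h2.2.symm⟩
  have hn := (key (k - 1) (by omega)).1
  refine hw.not_periodic (s := s + (n - (k + p))) (l := k + p) hp (by omega) fun i hi => ?_
  have := (key (k - 1 - i) (by omega)).2
  rw [show s + (n - 1 - (k - 1 - i)) = s + (n - (k + p)) + (i + p) by omega,
    show s + (n - 1 - (p + (k - 1 - i))) = s + (n - (k + p)) + i by omega] at this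
  exact this.symm

theorem isFactor_of_agreeUpTo {w : InfWord} {s n : ℕ} {f : Word}
    (h : agreeUpTo f.length f (revFactor w s n) = true) : IsFactor f.reverse w := by
  have hf : f = (revFactor w s n).take f.length := by
    refine List.ext_getElem? fun i => ?_
    rw [List.getElem?_take]
    split_ifs with hi
    · obtain ⟨a, h1, h2⟩ := exists_getElem?_of_agreeUpTo h hi
      rw [h1, h2]
    · exact List.getElem?_eq_none (by omega)
  have hn : f.length ≤ n := by
    have := congrArg List.length hf
    rw [List.length_take, length_revFactor] at this
    omega
  rw [hf, take_revFactor hn, revFactor, List.reverse_reverse]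
  exact isFactor_map_range ..

/-- The codes of the reversed length-`k` factors of `w`. -/
def factorCodes (w : InfWord) (k : ℕ) : Set ℕ :=
  (fun u : Word => letterCode k u.reverse) '' {u : Word | IsFactor u w ∧ u.length = k}

theorem letterCode_revFactor_mem {w : InfWord} {s n k : ℕ} (hk : k ≤ n) :
    letterCode k (revFactor w s n) ∈ factorCodes w k := by
  refine ⟨_, ⟨isFactor_map_range w (s + (n - k)) k, by simp⟩, ?_⟩
  change letterCode k (revFactor w (s + (n - k)) k) = _
  simp only [letterCode, ← take_revFactor hk, List.take_take, min_self]

theorem length_le_complexity {w : InfWord} {k : ℕ} {seen : List ℕ} (hnd : seen.Nodup)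
    (hmem : ∀ c ∈ seen, c ∈ factorCodes w k) : seen.length ≤ complexity w k := by
  have hfin : {u : Word | IsFactor u w ∧ u.length = k}.Finite :=
    (List.finite_length_eq Sigma3 k).subset fun _ hu => hu.2
  rw [← List.toFinset_card_of_nodup hnd, ← Set.ncard_coe_finset]
  calc (seen.toFinset : Set ℕ).ncard ≤ (factorCodes w k).ncard :=
        Set.ncard_le_ncard (fun c hc => hmem c (by simpa using hc)) (hfin.image _)
    _ ≤ complexity w k := Set.ncard_image_le hfin

theorem search_revFactor_eq_false {w : InfWord} (hw : NoFiveHalves w) {k : ℕ}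
    (hc : complexity w k ≤ 2 * k + 1) {forb : List Word}
    (hforb : ∀ f ∈ forb, ¬ IsFactor f.reverse w) (fuel s n : ℕ) {seen : List ℕ}
    (hnd : seen.Nodup) (hmem : ∀ c ∈ seen, c ∈ factorCodes w k) :
    search k forb fuel (revFactor w s n) seen = false := by
  induction fuel generalizing n seen with
  | zero => rfl
  | succ fuel ih =>
    have step : ∀ l : List ℕ, l.Nodup → (∀ c ∈ l, c ∈ factorCodes w k) →
        (search k forb fuel (0 :: revFactor w s n) l &&
          search k forb fuel (1 :: revFactor w s n) l &&
          search k forb fuel (2 :: revFactor w s n) l) = false := by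
      intro l h1 h2
      have h := ih (n + 1) h1 h2
      rw [revFactor_succ] at h
      generalize w (s + n) = a at h
      fin_cases a <;> simp_all
    have hbad : startsBadly forb (revFactor w s n) = false := by
      rw [startsBadly, Bool.or_eq_false_iff, List.any_eq_false, List.any_eq_false]
      refine ⟨fun f hf h => hforb f hf (isFactor_of_agreeUpTo h), fun p hp => ?_⟩
      have hp' : 1 ≤ p := Nat.pos_of_ne_zero fun h0 => by simp [h0] at hp
      rw [hw.startsWithPower_eq_false s n hp']
      exact Bool.false_ne_true
    rw [search, hbad, Bool.false_or, addCode, length_revFactor]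
    by_cases hn : n < k
    · rw [show Nat.blt n k = true from (iff_of_eq Nat.blt_eq).mpr hn]
      exact step seen hnd hmem
    rw [Bool.eq_false_iff.2 fun h => hn ((iff_of_eq Nat.blt_eq).mp h), cond_false]
    cases hs : seen.any (Nat.beq (letterCode k (revFactor w s n))) with
    | true => exact step seen hnd hmem
    | false =>
      have hnew : letterCode k (revFactor w s n) ∉ seen := fun h =>
        List.any_eq_false.1 hs _ h (by simp)
      have hnd' := List.nodup_cons.2 ⟨hnew, hnd⟩
      have hmem' : ∀ c ∈ letterCode k (revFactor w s n) :: seen, c ∈ factorCodes w k :=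
        List.forall_mem_cons.2 ⟨letterCode_revFactor_mem (by omega), hmem⟩
      have hlen := (length_le_complexity hnd' hmem').trans hc
      rw [List.length_cons] at hlen
      rw [Bool.eq_false_iff.2 fun h => absurd ((iff_of_eq Nat.blt_eq).mp h) (by omega)]
      exact step _ hnd' hmem'

theorem not_isFactor_of_search {w : InfWord} (hw : NoFiveHalves w) {k : ℕ}
    (hc : complexity w k ≤ 2 * k + 1) {forb : List Word}
    (hforb : ∀ f ∈ forb, ¬ IsFactor f.reverse w) {fuel : ℕ} {u : Word}
    (h : search k forb fuel u [] = true) : ¬ IsFactor u.reverse w := by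
  rintro ⟨s, hs⟩
  have hu : u = revFactor w s u.reverse.length := by
    rw [revFactor, ← hs, List.reverse_reverse]
  rw [hu, search_revFactor_eq_false hw hc hforb fuel s _ List.nodup_nil (by simp)] at h
  exact Bool.false_ne_true h

/-- There is no infinite word over Σ₃ avoiding exponents `≥ 5/2`, with factor
complexity `2n+1`, omitting all the listed factors. -/
theorem stmt17 :
    ¬ ∃ w : InfWord, NoFiveHalves w ∧ (∀ n : ℕ, complexity w n = 2 * n + 1) ∧
      (¬ IsFactor [0, 0] w ∧
      ¬ IsFactor [1, 2] w ∧
      ¬ IsFactor [2, 1] w ∧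
      ¬ IsFactor [2, 2] w ∧
      ¬ IsFactor [0, 1, 0, 1] w ∧
      ¬ IsFactor [1, 0, 1, 0] w) := by
  rintro ⟨w, hw, hc, h00, h12, h21, h22, h0101, h1010⟩
  have forb₄ : ∀ f ∈ forbiddenReversed.drop 4, ¬ IsFactor f.reverse w := by
    simp [forbiddenReversed, *]
  have forb₃ : ∀ f ∈ forbiddenReversed.drop 3, ¬ IsFactor f.reverse w :=
    List.forall_mem_cons.2 ⟨not_isFactor_of_search hw (hc 3).le forb₄ search_202, forb₄⟩
  have forb₂ : ∀ f ∈ forbiddenReversed.drop 2, ¬ IsFactor f.reverse w :=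
    List.forall_mem_cons.2 ⟨not_isFactor_of_search hw (hc 9).le forb₃ search_0201102011, forb₃⟩
  have forb₁ : ∀ f ∈ forbiddenReversed.drop 1, ¬ IsFactor f.reverse w :=
    List.forall_mem_cons.2 ⟨not_isFactor_of_search hw (hc 9).le forb₂ search_0201102, forb₂⟩
  have forb₀ : ∀ f ∈ forbiddenReversed, ¬ IsFactor f.reverse w :=
    List.forall_mem_cons.2 ⟨not_isFactor_of_search hw (hc 9).le forb₁ search_0, forb₁⟩
  exact not_isFactor_of_search hw (hc 9).le forb₀ search_nil ⟨0, rfl⟩
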